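/- arXiv:1304.4317 — 10 statements merged into one kernel-verified Lean document; each statement's English description precedes it below -/
import Mathlib

section
/- Let A, B > 0 and ε > 0, and let (y_k)_{k≥1} be the exact hysteresis sequence. Then for every k ≥ 1, if k is odd y_k = −√2·√(k + (k−1)B/A)·√ε, and if k is even y_k = −√2·√((k−1) + kB/A)·√ε. -/
/-- Closed form of a sequence satisfying `u (n + 1) = -√(u n ^ 2 + d)`. -/
theorem eq_neg_sqrt_of_sq_recurrence {u : ℕ → ℝ} {c d : ℝ} (hc : 0 ≤ c) (hd : 0 ≤ d)
    (h0 : u 0 = -Real.sqrt c) (hu : ∀ n, u (n + 1) = -Real.sqrt (u n ^ 2 + d)) (n : ℕ) :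
    u n = -Real.sqrt (c + n * d) := by
  induction n with
  | zero => simpa using h0
  | succ n ih =>
    rw [hu, ih, neg_sq, Real.sq_sqrt (by positivity)]
    push_cast
    ring_nf

theorem neg_sqrt_two_mul_mul {a b : ℝ} (hb : 0 ≤ b) :
    -Real.sqrt 2 * Real.sqrt a * Real.sqrt b = -Real.sqrt (2 * a * b) := by
  rw [Real.sqrt_mul' _ hb, Real.sqrt_mul zero_le_two]
  ring

/-- The exact hysteresis sequence `y` for parameters `A, B > 0` and `ε > 0`,
defined by `y₁ = −√(2ε)`, `y₂ = −√(2(1 + 2B/A)ε)`, and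
`y_k = −√(y_{k−2}² + 4(1 + B/A)ε)` for `k ≥ 3`, satisfies the explicit formula
`y_k = −√2·√(k + (k−1)B/A)·√ε` for odd `k` and
`y_k = −√2·√((k−1) + kB/A)·√ε` for even `k`. -/
theorem stmt0 (A B ε : ℝ) (hA : 0 < A) (hB : 0 < B) (hε : 0 < ε)
    (y : ℕ → ℝ)
    (h1 : y 1 = -Real.sqrt (2 * ε))
    (h2 : y 2 = -Real.sqrt (2 * (1 + 2 * B / A) * ε))
    (hrec : ∀ k : ℕ, 3 ≤ k → y k = -Real.sqrt ((y (k - 2)) ^ 2 + 4 * (1 + B / A) * ε)) :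
    ∀ k : ℕ, 1 ≤ k →
      (Odd k → y k = -Real.sqrt 2 * Real.sqrt ((k : ℝ) + ((k : ℝ) - 1) * B / A) * Real.sqrt ε) ∧
      (Even k → y k = -Real.sqrt 2 * Real.sqrt (((k : ℝ) - 1) + (k : ℝ) * B / A) * Real.sqrt ε) := by
  intro k hk
  simp only [neg_sqrt_two_mul_mul hε.le]
  constructor
  · rintro ⟨m, rfl⟩
    have h := eq_neg_sqrt_of_sq_recurrence (u := fun n => y (2 * n + 1))
      (c := 2 * ε) (d := 4 * (1 + B / A) * ε) (by positivity) (by positivity) h1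
      (fun n => hrec (2 * (n + 1) + 1) (by omega)) m
    refine h.trans ?_
    push_cast
    ring_nf
  · rintro ⟨m, rfl⟩
    obtain ⟨n, rfl⟩ : ∃ n, m = n + 1 := ⟨m - 1, by omega⟩
    have h := eq_neg_sqrt_of_sq_recurrence (u := fun n => y (n + 1 + (n + 1)))
      (c := 2 * (1 + 2 * B / A) * ε) (d := 4 * (1 + B / A) * ε) (by positivity) (by positivity) h2
      (fun n => by
        have := hrec (n + 1 + 1 + (n + 1 + 1)) (by omega)
        rwa [show n + 1 + 1 + (n + 1 + 1) - 2 = n + 1 + (n + 1) by omega] at this) n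
    refine h.trans ?_
    push_cast
    ring_nf
end

section
/- Let A, B > 0 and ε > 0, and let (y_k)_{k≥1} be the exact hysteresis sequence. For odd k ≥ 3 define q_k = (y_{k−1} − y_k)/(y_{k−2} − y_k). Then q_k → A/(A+B) as k → ∞ along odd integers. -/
open Filter

/-- A sequence with `u (n + 1) = -√(u n ^ 2 + c)` is given in closed form by the arithmetic
progression of its squares. -/
lemma eq_neg_sqrt_of_neg_sqrt_rec {u : ℕ → ℝ} {s c : ℝ} (hs : 0 ≤ s) (hc : 0 ≤ c)
    (h0 : u 0 = -√s) (hu : ∀ n, u (n + 1) = -√(u n ^ 2 + c)) (n : ℕ) :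
    u n = -√(s + c * n) := by
  induction n with
  | zero => simpa using h0
  | succ n ih =>
    rw [hu, ih, neg_sq, Real.sq_sqrt (by positivity)]
    push_cast
    ring_nf

/-- A ratio of differences of positive numbers whose squares differ by constants, written as its
limiting value minus an error term. -/
lemma sub_div_sub_eq_sub_error {a b d K c : ℝ} (ha : 0 < a) (hb : 0 < b) (hd : 0 < d)
    (hc : 0 < c) (hab : a ^ 2 = b ^ 2 + K) (hdb : d ^ 2 = b ^ 2 + c) :
    (-a - -d) / (-b - -d) = (c - K) / c - (c - K) / c * K / ((a + b) * (a + d)) := by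
  have hne : -b - -d ≠ 0 := by
    intro h
    have : d = b := by linarith
    subst this
    linarith
  have hK : K = (a - b) * (a + b) := by linarith
  have hc' : c = (d - b) * (d + b) := by linarith
  have hdb' : d - b ≠ 0 := fun h => hne (by linarith)
  subst hK hc'
  rw [show -b - -d = d - b by ring]
  field_simp
  ring

/-- For the exact hysteresis sequence `y` (with `y₁ = −√(2ε)`, `y₂ = −√(2(1 + 2B/A)ε)`,
`y_k = −√(y_{k−2}² + 4(1 + B/A)ε)` for `k ≥ 3`), the ratios
`q_k = (y_{k−1} − y_k)/(y_{k−2} − y_k)` over odd `k ≥ 3` (written `k = 2n + 3`)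
converge to `A/(A+B)` as `k → ∞` along odd integers. -/
theorem stmt1 (A B ε : ℝ) (hA : 0 < A) (hB : 0 < B) (hε : 0 < ε)
    (y : ℕ → ℝ)
    (h1 : y 1 = -Real.sqrt (2 * ε))
    (h2 : y 2 = -Real.sqrt (2 * (1 + 2 * B / A) * ε))
    (hrec : ∀ k : ℕ, 3 ≤ k → y k = -Real.sqrt ((y (k - 2)) ^ 2 + 4 * (1 + B / A) * ε)) :
    Tendsto (fun n : ℕ => (y (2 * n + 2) - y (2 * n + 3)) / (y (2 * n + 1) - y (2 * n + 3)))
      atTop (nhds (A / (A + B))) := by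
  have hc : 0 < 4 * (1 + B / A) * ε := by positivity
  set c := 4 * (1 + B / A) * ε with hc_def
  set K := 4 * (B / A) * ε with hK_def
  have hK : 0 < K := by positivity
  have hodd (n : ℕ) : y (2 * n + 1) = -√(2 * ε + c * n) :=
    eq_neg_sqrt_of_neg_sqrt_rec (u := fun n => y (2 * n + 1)) (by positivity) hc.le h1
      (fun n => hrec (2 * (n + 1) + 1) (by omega)) n
  have heven (n : ℕ) : y (2 * n + 2) = -√(2 * ε + K + c * n) :=
    eq_neg_sqrt_of_neg_sqrt_rec (u := fun n => y (2 * n + 2)) (by positivity) hc.le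
      (by rw [show 2 * ε + K = 2 * (1 + 2 * B / A) * ε by rw [hK_def]; ring]; exact h2)
      (fun n => hrec (2 * (n + 1) + 2) (by omega)) n
  have hlim : (c - K) / c = A / (A + B) := by
    rw [hc_def, hK_def]
    field_simp
    ring
  have hq (n : ℕ) : (y (2 * n + 2) - y (2 * n + 3)) / (y (2 * n + 1) - y (2 * n + 3)) =
      A / (A + B) - A / (A + B) * K /
        ((√(2 * ε + K + c * n) + √(2 * ε + c * n)) *
          (√(2 * ε + K + c * n) + √(2 * ε + c * (n + 1 : ℕ)))) := by
    rw [show 2 * n + 3 = 2 * (n + 1) + 1 by ring, hodd, hodd, heven, ← hlim]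
    apply sub_div_sub_eq_sub_error (by positivity) (by positivity) (by positivity) hc
    · rw [Real.sq_sqrt (by positivity), Real.sq_sqrt (by positivity)]
      ring
    · rw [Real.sq_sqrt (by positivity), Real.sq_sqrt (by positivity)]
      push_cast
      ring
  simp_rw [hq]
  have hden : Tendsto (fun n : ℕ => (√(2 * ε + K + c * n) + √(2 * ε + c * n)) *
      (√(2 * ε + K + c * n) + √(2 * ε + c * (n + 1 : ℕ)))) atTop atTop := by
    refine tendsto_atTop_mono (fun n => ?_) (tendsto_natCast_atTop_atTop.const_mul_atTop hc)
    calc c * n ≤ √(2 * ε + K + c * n) * √(2 * ε + K + c * n) := by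
          rw [Real.mul_self_sqrt (by positivity)]
          linarith
      _ ≤ _ := by
          gcongr
          · exact le_add_of_nonneg_right (Real.sqrt_nonneg _)
          · exact le_add_of_nonneg_right (Real.sqrt_nonneg _)
  simpa using (hden.const_div_atTop (A / (A + B) * K)).const_sub (A / (A + B))
end

section
/- Let A, B > 0 and fix real numbers y_min < y_max < 0. For each ε > 0 let (y_k(ε))_{k≥1} be the exact hysteresis sequence, and (for ε small enough that such indices exist) let k_min(ε) and k_max(ε) be respectively the smallest and largest odd integers k with y_k(ε) ∈ [y_min, y_max]. Then the ratio (Σ_{k = k_min+2, k_min+4, …, k_max, k odd} (y_{k−1}(ε) − y_k(ε))) / (y_{k_min}(ε) − y_{k_max}(ε)) converges to A/(A+B) as ε → 0⁺. -/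
open Filter Set

/-- Closed form of a sequence of nonpositive reals whose squares increase by `d` at each step. -/
lemma eq_neg_sqrt_add_nat_mul {z : ℕ → ℝ} {a d : ℝ} (ha : 0 ≤ a) (hd : 0 ≤ d)
    (h0 : z 0 = -√a) (hz : ∀ m, z (m + 1) = -√(z m ^ 2 + d)) (m : ℕ) :
    z m = -√(a + m * d) := by
  induction m with
  | zero => simpa using h0
  | succ m ih =>
    rw [hz, ih, neg_sq, Real.sq_sqrt (by positivity)]
    push_cast
    ring_nf

lemma mul_sqrt_sub_sqrt_le {t b c e : ℝ} (ht : 0 < t) (hb : 0 ≤ b) (he : 0 ≤ e)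
    (hc : c = 1 + b) :
    c * (√(t + 4 * c * e) - √(t + 4 * b * e)) ≤ √(t + 4 * c * e) - √t := by
  subst hc
  have hs := Real.sq_sqrt ht.le
  have hu := Real.sq_sqrt (show 0 ≤ t + 4 * b * e by positivity)
  have hv := Real.sq_sqrt (show 0 ≤ t + 4 * (1 + b) * e by positivity)
  have hsu : √t ≤ √(t + 4 * b * e) := Real.sqrt_le_sqrt (le_add_of_nonneg_right (by positivity))
  have hsv : √t ≤ √(t + 4 * (1 + b) * e) :=
    Real.sqrt_le_sqrt (le_add_of_nonneg_right (by positivity))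
  have hs0 : 0 < √t := Real.sqrt_pos.2 ht
  set s := √t
  set u := √(t + 4 * b * e)
  set v := √(t + 4 * (1 + b) * e)
  have key : (1 + b) * (v - u) * (v + u) = (v - s) * (v + s) := by
    linear_combination b * hv - (1 + b) * hu + hs
  refine le_of_mul_le_mul_right ?_ (show 0 < v + u by linarith)
  rw [key]
  exact mul_le_mul_of_nonneg_left (by linarith) (by linarith)

lemma div_sqrt_mul_sqrt_le {p t d : ℝ} (hp : 0 < p) (hd : 0 ≤ d) (hpt : p ^ 2 ≤ t) :
    p / √(p ^ 2 + d) * √(t + d) ≤ √t := by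
  rw [div_mul_eq_mul_div, div_le_iff₀ (by positivity), ← Real.sqrt_mul (by nlinarith)]
  apply Real.le_sqrt_of_sq_le
  rw [mul_pow, Real.sq_sqrt (by nlinarith)]
  nlinarith

lemma le_mul_sqrt_sub_sqrt {t b c e p : ℝ} (hp : 0 < p) (hpt : p ^ 2 ≤ t) (hb : 0 ≤ b)
    (he : 0 ≤ e) (hc : c = 1 + b) :
    p / √(p ^ 2 + 4 * c * e) * (√(t + 4 * c * e) - √t) ≤
      c * (√(t + 4 * c * e) - √(t + 4 * b * e)) := by
  subst hc
  have ht : 0 < t := lt_of_lt_of_le (by positivity) hpt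
  have hr := div_sqrt_mul_sqrt_le hp (show 0 ≤ 4 * (1 + b) * e by positivity) hpt
  have hs := Real.sq_sqrt ht.le
  have hu := Real.sq_sqrt (show 0 ≤ t + 4 * b * e by positivity)
  have hv := Real.sq_sqrt (show 0 ≤ t + 4 * (1 + b) * e by positivity)
  have huv : √(t + 4 * b * e) ≤ √(t + 4 * (1 + b) * e) := Real.sqrt_le_sqrt (by nlinarith)
  have hsv : √t ≤ √(t + 4 * (1 + b) * e) :=
    Real.sqrt_le_sqrt (le_add_of_nonneg_right (by positivity))
  have hs0 : 0 < √t := Real.sqrt_pos.2 ht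
  have hu0 : 0 ≤ √(t + 4 * b * e) := Real.sqrt_nonneg _
  have hr0 : 0 ≤ p / √(p ^ 2 + 4 * (1 + b) * e) := by positivity
  set s := √t
  set u := √(t + 4 * b * e)
  set v := √(t + 4 * (1 + b) * e)
  set r := p / √(p ^ 2 + 4 * (1 + b) * e)
  have key : (1 + b) * (v - u) * (v + u) = (v - s) * (v + s) := by
    linear_combination b * hv - (1 + b) * hu + hs
  refine le_of_mul_le_mul_right ?_ (show 0 < v + u by linarith)
  rw [key]
  calc r * (v - s) * (v + u) = (v - s) * (r * (v + u)) := by ring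
    _ ≤ (v - s) * (v + s) := by
      refine mul_le_mul_of_nonneg_left ?_ (by linarith)
      have : r * u ≤ r * v := mul_le_mul_of_nonneg_left huv hr0
      linarith

/-- An interval of length at least twice the step contains two consecutive terms of an arithmetic
progression starting to its left. -/
lemma exists_nat_two_terms_mem {a d L U : ℝ} (hd : 0 < d) (haL : a ≤ L) (hLU : L + 2 * d ≤ U) :
    ∃ m : ℕ, L ≤ a + m * d ∧ a + (m + 1 : ℕ) * d ≤ U := by
  refine ⟨⌈(L - a) / d⌉₊, ?_, ?_⟩
  · have := Nat.le_ceil ((L - a) / d)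
    rw [div_le_iff₀ hd] at this
    linarith
  · have := Nat.ceil_lt_add_one (div_nonneg (sub_nonneg.2 haL) hd.le)
    rw [← sub_lt_iff_lt_add, lt_div_iff₀ hd] at this
    push_cast
    linarith

lemma neg_sqrt_mem_Icc_iff {a b t : ℝ} (ha : a < 0) (hb : b < 0) :
    -√t ∈ Icc a b ↔ b ^ 2 ≤ t ∧ t ≤ a ^ 2 := by
  rw [mem_Icc, neg_le, le_neg, Real.sqrt_le_left (by linarith),
    Real.le_sqrt' (by linarith), neg_sq, neg_sq, and_comm]

/-- Bounds for the ratio of gap lengths along a sequence with explicit odd and even terms. -/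
lemma sum_gaps_div_mem_Icc {x : ℕ → ℝ} {a b c e p : ℝ} (hp : 0 < p) (hb : 0 ≤ b) (he : 0 < e)
    (hc : c = 1 + b)
    (hodd : ∀ m : ℕ, x (2 * m + 1) = -√(a + m * (4 * c * e)))
    (heven : ∀ m : ℕ, x (2 * m + 2) = -√(a + 4 * b * e + m * (4 * c * e)))
    {m n : ℕ} (hn : 0 < n) (hm : p ^ 2 ≤ a + m * (4 * c * e)) :
    (∑ j ∈ Finset.range n, (x (2 * m + 1 + 2 * j + 1) - x (2 * m + 1 + 2 * j + 2))) /
        (x (2 * m + 1) - x (2 * (m + n) + 1)) ∈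
      Icc (p / √(p ^ 2 + 4 * c * e) / c) (1 / c) := by
  have hc0 : 0 < c := by linarith
  have hd0 : 0 < 4 * c * e := by positivity
  have htele : x (2 * m + 1) - x (2 * (m + n) + 1) =
      ∑ j ∈ Finset.range n, (x (2 * (m + j) + 1) - x (2 * (m + (j + 1)) + 1)) :=
    (Finset.sum_range_sub' (fun j => x (2 * (m + j) + 1)) n).symm
  have ht (j : ℕ) : p ^ 2 ≤ a + (m + j : ℕ) * (4 * c * e) := by
    push_cast
    have : 0 ≤ (j : ℝ) * (4 * c * e) := by positivity
    linarith
  have hgap (j : ℕ) : x (2 * m + 1 + 2 * j + 1) - x (2 * m + 1 + 2 * j + 2) =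
      √(a + (m + j : ℕ) * (4 * c * e) + 4 * c * e) -
        √(a + (m + j : ℕ) * (4 * c * e) + 4 * b * e) := by
    rw [show 2 * m + 1 + 2 * j + 1 = 2 * (m + j) + 2 by ring,
      show 2 * m + 1 + 2 * j + 2 = 2 * (m + j + 1) + 1 by ring, hodd, heven]
    push_cast
    ring_nf
  have hstep (j : ℕ) : x (2 * (m + j) + 1) - x (2 * (m + (j + 1)) + 1) =
      √(a + (m + j : ℕ) * (4 * c * e) + 4 * c * e) - √(a + (m + j : ℕ) * (4 * c * e)) := by
    rw [hodd, hodd]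
    push_cast
    ring_nf
  have hpos : 0 < x (2 * m + 1) - x (2 * (m + n) + 1) := by
    rw [htele]
    refine Finset.sum_pos (fun j _ => ?_) (Finset.nonempty_range_iff.2 hn.ne')
    rw [hstep, sub_pos]
    exact Real.sqrt_lt_sqrt ((sq_nonneg p).trans (ht j)) (by linarith)
  rw [mem_Icc, div_le_iff₀ hc0, le_div_iff₀ hc0, div_mul_eq_mul_div, le_div_iff₀ hpos,
    div_le_iff₀ hpos, one_mul, htele, Finset.mul_sum, Finset.sum_mul]
  constructor
  · refine Finset.sum_le_sum fun j _ => ?_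
    rw [hgap, hstep, mul_comm (_ - _) c]
    exact le_mul_sqrt_sub_sqrt hp (ht j) hb he.le hc
  · refine Finset.sum_le_sum fun j _ => ?_
    rw [hgap, hstep, mul_comm (_ - _) c]
    exact mul_sqrt_sub_sqrt_le (lt_of_lt_of_le (by positivity) (ht j)) hb he.le hc

/-- Idealized form of the paper's Lemma 1 (hysteresis). For parameters `A, B > 0` and a fixed
interval `[y_min, y_max]` with `y_min < y_max < 0`, let `y ε` be the exact hysteresis sequence
for each `ε > 0`, and for `ε ∈ (0, ε₀)` let `kmin ε` and `kmax ε` be the smallest and largest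
odd indices `k ≥ 1` with `y ε k ∈ [y_min, y_max]`. Then the fraction
`(Σ_{k odd, k_min < k ≤ k_max} (y_{k−1} − y_k)) / (y_{k_min} − y_{k_max})`
tends to `A/(A+B)` as `ε → 0⁺`. The sum over odd `k = kmin + 2, kmin + 4, …, kmax` is written
with `k = kmin ε + 2*(j+1)`, `j = 0, …, (kmax ε − kmin ε)/2 − 1`. -/
theorem stmt2 (A B : ℝ) (hA : 0 < A) (hB : 0 < B)
    (ymin ymax : ℝ) (hyy : ymin < ymax) (hymax : ymax < 0)
    (y : ℝ → ℕ → ℝ)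
    (h1 : ∀ ε : ℝ, 0 < ε → y ε 1 = -Real.sqrt (2 * ε))
    (h2 : ∀ ε : ℝ, 0 < ε → y ε 2 = -Real.sqrt (2 * (1 + 2 * B / A) * ε))
    (hrec : ∀ ε : ℝ, 0 < ε → ∀ k : ℕ, 3 ≤ k →
      y ε k = -Real.sqrt ((y ε (k - 2)) ^ 2 + 4 * (1 + B / A) * ε))
    (kmin kmax : ℝ → ℕ) (ε₀ : ℝ) (hε₀ : 0 < ε₀)
    (hkmin : ∀ ε ∈ Ioo (0 : ℝ) ε₀,
      IsLeast {k : ℕ | Odd k ∧ 1 ≤ k ∧ y ε k ∈ Icc ymin ymax} (kmin ε))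
    (hkmax : ∀ ε ∈ Ioo (0 : ℝ) ε₀,
      IsGreatest {k : ℕ | Odd k ∧ 1 ≤ k ∧ y ε k ∈ Icc ymin ymax} (kmax ε)) :
    Tendsto (fun ε : ℝ =>
        (∑ j ∈ Finset.range ((kmax ε - kmin ε) / 2),
            (y ε (kmin ε + 2 * j + 1) - y ε (kmin ε + 2 * j + 2))) /
          (y ε (kmin ε) - y ε (kmax ε)))
      (nhdsWithin 0 (Ioi 0)) (nhds (A / (A + B))) := by
  set b := B / A with hb_def
  have hb : 0 < b := div_pos hB hA
  obtain ⟨c, hc⟩ : ∃ c, c = 1 + b := ⟨_, rfl⟩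
  have hc0 : 0 < c := by linarith
  have hlim : A / (A + B) = 1 / c := by
    rw [hc, hb_def]
    field_simp
  have hp : 0 < -ymax := by linarith
  have hodd (ε : ℝ) (hε : 0 < ε) (m : ℕ) :
      y ε (2 * m + 1) = -√(2 * ε + m * (4 * c * ε)) := by
    refine eq_neg_sqrt_add_nat_mul (z := fun m => y ε (2 * m + 1)) (by positivity)
      (by positivity) (h1 ε hε) (fun m => ?_) m
    rw [hrec ε hε _ (by omega), hc]
    rfl
  have heven (ε : ℝ) (hε : 0 < ε) (m : ℕ) :
      y ε (2 * m + 2) = -√(2 * ε + 4 * b * ε + m * (4 * c * ε)) := by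
    refine eq_neg_sqrt_add_nat_mul (z := fun m => y ε (2 * m + 2)) (by positivity)
      (by positivity) ?_ (fun m => ?_) m
    · rw [h2 ε hε, hb_def]
      ring_nf
    · rw [hrec ε hε _ (by omega), hc]
      rfl
  have hev : ∀ᶠ ε : ℝ in nhdsWithin 0 (Ioi 0), 0 < ε ∧ ε < ε₀ ∧ 2 * ε ≤ ymax ^ 2 ∧
      ymax ^ 2 + 2 * (4 * c * ε) ≤ ymin ^ 2 := by
    have hlt {f : ℝ → ℝ} (hf : Continuous f) {v : ℝ} (h0 : f 0 < v) :
        ∀ᶠ ε in nhdsWithin 0 (Ioi 0), f ε < v :=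
      (hf.tendsto 0).eventually_lt_const h0 |>.filter_mono nhdsWithin_le_nhds
    filter_upwards [self_mem_nhdsWithin, hlt continuous_id hε₀,
      hlt (f := fun ε => 2 * ε) (by fun_prop) (v := ymax ^ 2) (by nlinarith),
      hlt (f := fun ε => ymax ^ 2 + 2 * (4 * c * ε)) (by fun_prop) (v := ymin ^ 2)
        (by nlinarith)] with ε h₁ h₂ h₃ h₄
    exact ⟨h₁, h₂, h₃.le, h₄.le⟩
  have hmem : ∀ᶠ ε : ℝ in nhdsWithin 0 (Ioi 0),
      (∑ j ∈ Finset.range ((kmax ε - kmin ε) / 2),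
          (y ε (kmin ε + 2 * j + 1) - y ε (kmin ε + 2 * j + 2))) /
        (y ε (kmin ε) - y ε (kmax ε)) ∈
      Icc (-ymax / √((-ymax) ^ 2 + 4 * c * ε) / c) (1 / c) := by
    filter_upwards [hev] with ε ⟨hε, hεε₀, hεmax, hεmin⟩
    have hd : 0 < 4 * c * ε := by positivity
    have hIcc (k : ℕ) : y ε (2 * k + 1) ∈ Icc ymin ymax ↔
        ymax ^ 2 ≤ 2 * ε + k * (4 * c * ε) ∧ 2 * ε + k * (4 * c * ε) ≤ ymin ^ 2 := by
      rw [hodd ε hε, neg_sqrt_mem_Icc_iff (hyy.trans hymax) hymax]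
    obtain ⟨i, hi₁, hi₂⟩ := exists_nat_two_terms_mem hd hεmax hεmin
    have hstep : (i : ℝ) * (4 * c * ε) ≤ (i + 1 : ℕ) * (4 * c * ε) := by gcongr; simp
    have hmin := hkmin ε ⟨hε, hεε₀⟩
    have hmax := hkmax ε ⟨hε, hεε₀⟩
    have hle := hmin.2 ⟨odd_two_mul_add_one i, by omega, (hIcc i).2 ⟨hi₁, by linarith⟩⟩
    have hge := hmax.2 ⟨odd_two_mul_add_one (i + 1), by omega,
      (hIcc (i + 1)).2 ⟨by linarith, hi₂⟩⟩
    obtain ⟨⟨m, hm⟩, -, hmI⟩ := hmin.1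
    obtain ⟨⟨l, hl⟩, -, -⟩ := hmax.1
    rw [hm] at hle hmI
    rw [hl] at hge
    obtain ⟨n, rfl⟩ := Nat.exists_eq_add_of_le (show m ≤ l by omega)
    rw [hm, hl, show (2 * (m + n) + 1 - (2 * m + 1)) / 2 = n by omega]
    refine sum_gaps_div_mem_Icc hp hb.le hε hc (hodd ε hε) (heven ε hε) (by omega) ?_
    rw [neg_sq]
    exact ((hIcc m).1 hmI).1
  rw [hlim]
  refine tendsto_of_tendsto_of_tendsto_of_le_of_le' ?_ tendsto_const_nhds
    (hmem.mono fun _ h => h.1) (hmem.mono fun _ h => h.2)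
  have hcont : ContinuousAt (fun ε : ℝ => -ymax / √((-ymax) ^ 2 + 4 * c * ε) / c) 0 := by
    refine ContinuousAt.div_const (ContinuousAt.div (by fun_prop) (by fun_prop) ?_) c
    simpa [Real.sqrt_sq_eq_abs] using hymax.ne
  have h0 : -ymax / √((-ymax) ^ 2 + 4 * c * 0) / c = 1 / c := by
    rw [mul_zero, add_zero, Real.sqrt_sq hp.le, div_self hp.ne']
  exact h0 ▸ hcont.tendsto.mono_left nhdsWithin_le_nhds
end

section
/- Let a, b, c, x be real numbers with a > 0, c > 0, b ≠ 0, b² < 4ac, and |x| < a/|b|. Then |√(a + bx + cx²) − √a − (b/(2√a))·x| ≤ ((4ac − b²)/(4a^{3/2}))·x². -/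
/-- First-order Taylor bound for `√(a + bx + cx²)`: if `a, c > 0`, `b ≠ 0`, `b² < 4ac` and
`|x| < a/|b|`, then `|√(a + bx + cx²) − √a − (b/(2√a))x| ≤ ((4ac − b²)/(4a^{3/2}))x²`. -/
theorem stmt4 (a b c x : ℝ) (ha : 0 < a) (hc : 0 < c) (hb : b ≠ 0)
    (hdisc : b ^ 2 < 4 * a * c) (hx : |x| < a / |b|) :
    |Real.sqrt (a + b * x + c * x ^ 2) - Real.sqrt a - (b / (2 * Real.sqrt a)) * x|
      ≤ ((4 * a * c - b ^ 2) / (4 * a ^ ((3 : ℝ) / 2))) * x ^ 2 := by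
  have hs : 0 < Real.sqrt a := Real.sqrt_pos.mpr ha
  have hpow : a ^ ((3 : ℝ) / 2) = Real.sqrt a ^ 3 := by
    rw [Real.sqrt_eq_rpow, ← Real.rpow_natCast, ← Real.rpow_mul ha.le]
    norm_num
  have hbx : |b * x| < a := by
    rw [lt_div_iff₀ (abs_pos.mpr hb)] at hx
    rwa [abs_mul, mul_comm]
  have hsq : Real.sqrt a ^ 2 = a := Real.sq_sqrt ha.le
  rw [hpow]
  generalize Real.sqrt a = s at *
  subst hsq
  set L := s + b / (2 * s) * x with hL
  set D := (4 * s ^ 2 * c - b ^ 2) / (4 * s ^ 3) * x ^ 2 with hD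
  have hD0 : 0 ≤ D :=
    mul_nonneg (div_nonneg (sub_nonneg.mpr hdisc.le) (by positivity)) (sq_nonneg x)
  have hL2 : s ≤ 2 * L := by
    have h : 2 * L - s = (s ^ 2 + b * x) / s := by
      rw [hL]
      field_simp
      ring
    have h' : 0 ≤ (s ^ 2 + b * x) / s :=
      div_nonneg (by linarith [neg_abs_le (b * x)]) hs.le
    linarith
  have hquad : s ^ 2 + b * x + c * x ^ 2 = L ^ 2 + s * D := by
    rw [hL, hD]
    field_simp
    ring
  have hlower : L ≤ Real.sqrt (s ^ 2 + b * x + c * x ^ 2) :=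
    Real.le_sqrt_of_sq_le (by rw [hquad]; nlinarith)
  have hupper : Real.sqrt (s ^ 2 + b * x + c * x ^ 2) ≤ L + D :=
    Real.sqrt_le_iff.mpr ⟨by linarith, by rw [hquad]; nlinarith⟩
  rw [abs_le]
  constructor <;> linarith
end

section
/- Let A, B > 0, let 0 < θ < 1, and let G : ℝ × (0,∞) → ℝ be a function with |G(y; ε)| ≤ M_G for all y and ε, for some constant M_G. For each ε > 0 define a sequence (y_k(ε))_{k≥1} by y₁(ε) = −√(2ε) + ζ₁(ε)ε and y₂(ε) = −√(2(1 + 2B/A)ε) + ζ₂(ε)ε, where ζ₁ and ζ₂ are functions of ε bounded uniformly for ε in (0, ε₀], and by the recursion y_k(ε) = −√(y_{k−2}(ε)² + 4(1 + B/A)ε) + G(y_{k−2}(ε); ε)·ε for k ≥ 3. Define ζ_k(ε) for k ≥ 3 by y_k(ε) = −√2·√(k + (k−1)B/A)·√ε + ζ_k(ε)ε for odd k and y_k(ε) = −√2·√((k−1) + kB/A)·√ε + ζ_k(ε)ε for even k. Then there exist constants M₁ > 0 and ε* > 0 such that for all ε ∈ (0, ε*] and all integers k with 1 ≤ k ≤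 ε^{−θ}, one has |ζ_k(ε)| ≤ k·M₁. -/
open Set

lemma sqrt_sq_add_le (x y : ℝ) {c : ℝ} (hc : 0 ≤ c) :
    √(x ^ 2 + c) ≤ √(y ^ 2 + c) + |x - y| := by
  have hy : |y| ≤ √(y ^ 2 + c) := Real.abs_le_sqrt (by linarith)
  have hsq : √(y ^ 2 + c) ^ 2 = y ^ 2 + c := Real.sq_sqrt (by positivity)
  refine Real.sqrt_le_iff.mpr ⟨by positivity, ?_⟩
  have h₁ : y * (x - y) ≤ √(y ^ 2 + c) * |x - y| :=
    (le_abs_self _).trans (abs_mul y (x - y) ▸ mul_le_mul_of_nonneg_right hy (abs_nonneg _))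
  nlinarith [sq_abs (x - y)]

/-- The map `x ↦ √(x² + c)` is nonexpansive. -/
lemma abs_sqrt_sq_add_sub_le (x y : ℝ) {c : ℝ} (hc : 0 ≤ c) :
    |√(x ^ 2 + c) - √(y ^ 2 + c)| ≤ |x - y| := by
  rw [abs_sub_le_iff]
  have h₁ := sqrt_sq_add_le x y hc
  have h₂ := sqrt_sq_add_le y x hc
  rw [abs_sub_comm y x] at h₂
  constructor <;> linarith

/-- One step of the perturbed recursion increases the correction by at most the bound on the
perturbation. -/
lemma abs_correction_step {ε c p q s t z w g M : ℝ} (hε : 0 < ε) (hc : 0 ≤ c) (ht : 0 ≤ t)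
    (hst : t ^ 2 = s ^ 2 + c) (hp : p = -s + z * ε) (hq : q = -t + w * ε)
    (hrec : q = -√(p ^ 2 + c) + g * ε) (hg : |g| ≤ M) : |w| ≤ |z| + M := by
  have hroot : √((-s) ^ 2 + c) = t := by rw [neg_sq, ← hst, Real.sqrt_sq ht]
  have hlip := abs_sqrt_sq_add_sub_le p (-s) hc
  rw [hroot, show p - -s = z * ε by rw [hp]; ring, abs_mul, abs_of_pos hε] at hlip
  have hw : (w - g) * ε = -(√(p ^ 2 + c) - t) := by linarith
  have hwz : |w - g| ≤ |z| := by
    refine le_of_mul_le_mul_right ?_ hε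
    rwa [← abs_of_pos hε, ← abs_mul, abs_of_pos hε, hw, abs_neg]
  have := abs_add_le (w - g) g
  rw [sub_add_cancel] at this
  linarith

/-- The coefficient under the square root of the unperturbed sequence, with `b = B / A`. -/
noncomputable def hysteresisCoeff (b : ℝ) (k : ℕ) : ℝ :=
  if Odd k then (k : ℝ) + ((k : ℝ) - 1) * b else ((k : ℝ) - 1) + (k : ℝ) * b

lemma hysteresisCoeff_nonneg {b : ℝ} (hb : 0 ≤ b) {k : ℕ} (hk : 1 ≤ k) :
    0 ≤ hysteresisCoeff b k := by
  have hk' : (0 : ℝ) ≤ (k : ℝ) - 1 := by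
    rw [sub_nonneg]
    exact_mod_cast hk
  unfold hysteresisCoeff
  split_ifs <;> positivity

lemma hysteresisCoeff_add_two (b : ℝ) (k : ℕ) :
    hysteresisCoeff b (k + 2) = hysteresisCoeff b k + 2 * (1 + b) := by
  have hpar : Odd (k + 2) ↔ Odd k := by grind
  simp only [hysteresisCoeff, hpar]
  split_ifs <;> push_cast <;> ring

/-- First key bound in the proof of the paper's Lemma 1: for the perturbed hysteresis
recursion `y_k = −√(y_{k−2}² + 4(1 + B/A)ε) + G(y_{k−2}; ε)ε` with bounded error `G` and
bounded initial corrections `ζ₁, ζ₂`, the corrections `ζ_k(ε)` defined by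
`y_k = −√2·√(k + (k−1)B/A)·√ε + ζ_k(ε)ε` (odd `k`) and
`y_k = −√2·√((k−1) + kB/A)·√ε + ζ_k(ε)ε` (even `k`)
satisfy `|ζ_k(ε)| ≤ k·M₁` for all `1 ≤ k ≤ ε^{−θ}` and all sufficiently small `ε > 0`. -/
theorem stmt5 (A B θ : ℝ) (hA : 0 < A) (hB : 0 < B) (hθ0 : 0 < θ) (hθ1 : θ < 1)
    (G : ℝ → ℝ → ℝ) (MG : ℝ) (hG : ∀ y : ℝ, ∀ ε : ℝ, 0 < ε → |G y ε| ≤ MG)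
    (ζ₁ ζ₂ : ℝ → ℝ) (ε₀ Mζ : ℝ) (hε₀ : 0 < ε₀)
    (hζ₁ : ∀ ε ∈ Ioc (0 : ℝ) ε₀, |ζ₁ ε| ≤ Mζ) (hζ₂ : ∀ ε ∈ Ioc (0 : ℝ) ε₀, |ζ₂ ε| ≤ Mζ)
    (y : ℝ → ℕ → ℝ)
    (hy1 : ∀ ε : ℝ, 0 < ε → y ε 1 = -Real.sqrt (2 * ε) + ζ₁ ε * ε)
    (hy2 : ∀ ε : ℝ, 0 < ε → y ε 2 = -Real.sqrt (2 * (1 + 2 * B / A) * ε) + ζ₂ ε * ε)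
    (hyrec : ∀ ε : ℝ, 0 < ε → ∀ k : ℕ, 3 ≤ k →
      y ε k = -Real.sqrt ((y ε (k - 2)) ^ 2 + 4 * (1 + B / A) * ε) + G (y ε (k - 2)) ε * ε)
    (ζ : ℝ → ℕ → ℝ)
    (hζone : ∀ ε : ℝ, 0 < ε → ζ ε 1 = ζ₁ ε)
    (hζtwo : ∀ ε : ℝ, 0 < ε → ζ ε 2 = ζ₂ ε)
    (hζodd : ∀ ε : ℝ, 0 < ε → ∀ k : ℕ, 3 ≤ k → Odd k →
      y ε k = -Real.sqrt 2 * Real.sqrt ((k : ℝ) + ((k : ℝ) - 1) * B / A) * Real.sqrt ε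
        + ζ ε k * ε)
    (hζeven : ∀ ε : ℝ, 0 < ε → ∀ k : ℕ, 3 ≤ k → Even k →
      y ε k = -Real.sqrt 2 * Real.sqrt (((k : ℝ) - 1) + (k : ℝ) * B / A) * Real.sqrt ε
        + ζ ε k * ε) :
    ∃ M₁ : ℝ, 0 < M₁ ∧ ∃ εs : ℝ, 0 < εs ∧ εs ≤ ε₀ ∧
      ∀ ε ∈ Ioc (0 : ℝ) εs, ∀ k : ℕ, 1 ≤ k → (k : ℝ) ≤ ε ^ (-θ) →
        |ζ ε k| ≤ (k : ℝ) * M₁ := by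
  have hb : 0 ≤ B / A := by positivity
  refine ⟨|Mζ| + |MG| + 1, by positivity, ε₀, hε₀, le_rfl, ?_⟩
  rintro ε hε k hk -
  have hε' : 0 < ε := hε.1
  have hy : ∀ k : ℕ, 1 ≤ k →
      y ε k = -√(2 * hysteresisCoeff (B / A) k * ε) + ζ ε k * ε := by
    intro k hk
    obtain rfl | rfl | hk3 : k = 1 ∨ k = 2 ∨ 3 ≤ k := by omega
    · rw [hy1 ε hε', hζone ε hε']
      simp [hysteresisCoeff]
    · have hcoeff : hysteresisCoeff (B / A) 2 = 1 + 2 * B / A := by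
        rw [hysteresisCoeff, if_neg (by decide)]
        push_cast
        ring
      rw [hy2 ε hε', hζtwo ε hε', hcoeff]
    · have hc := hysteresisCoeff_nonneg hb hk
      rw [Real.sqrt_mul (by positivity), Real.sqrt_mul (by positivity)]
      by_cases hodd : Odd k
      · rw [hζodd ε hε' k hk3 hodd, hysteresisCoeff, if_pos hodd, mul_div_assoc]
        ring
      · rw [hζeven ε hε' k hk3 (Nat.not_odd_iff_even.mp hodd), hysteresisCoeff, if_neg hodd,
          mul_div_assoc]
        ring
  induction k using Nat.strong_induction_on with
  | _ k ih =>
    obtain rfl | rfl | hk3 : k = 1 ∨ k = 2 ∨ 3 ≤ k := by omega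
    · rw [hζone ε hε']
      push_cast
      linarith [hζ₁ ε hε, le_abs_self Mζ, abs_nonneg MG]
    · rw [hζtwo ε hε']
      push_cast
      linarith [hζ₂ ε hε, le_abs_self Mζ, abs_nonneg Mζ, abs_nonneg MG]
    · obtain ⟨j, rfl⟩ : ∃ j, k = j + 2 := ⟨k - 2, by omega⟩
      have hj : 1 ≤ j := by omega
      have hcj := hysteresisCoeff_nonneg hb hj
      have hcj2 := hysteresisCoeff_nonneg hb hk
      have hrec := hyrec ε hε' (j + 2) hk3
      rw [Nat.add_sub_cancel] at hrec
      have hsq : √(2 * hysteresisCoeff (B / A) (j + 2) * ε) ^ 2 =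
          √(2 * hysteresisCoeff (B / A) j * ε) ^ 2 + 4 * (1 + B / A) * ε := by
        rw [Real.sq_sqrt (by positivity), Real.sq_sqrt (by positivity), hysteresisCoeff_add_two]
        ring
      have hstep := abs_correction_step hε' (by positivity) (Real.sqrt_nonneg _) hsq
        (hy j hj) (hy (j + 2) hk) hrec (hG _ ε hε')
      have hprev := ih j (by omega) hj
      push_cast
      linarith [le_abs_self MG, abs_nonneg MG, abs_nonneg Mζ]
end

section
/- Let A, B > 0 and M > 0. Then there exist constants C > 0 and c₀ > 0, depending only on A, B, M, with the following property. For every ε > 0, every odd integer k ≥ 3 with k^{3/2}·√ε ≤ c₀, and every choice of real numbers ζ_{k−2}, ζ_{k−1}, ζ_k with |ζ_j| ≤ j·M for j = k−2, k−1, k, if one sets y_j = −√2·√(j + (j−1)B/A)·√ε + ζ_j·ε for odd j and y_j = −√2·√((j−1) + jB/A)·√ε + ζ_j·ε for even j (j = k−2, k−1, k), then y_{k−2} − y_k ≠ 0 and |(y_{k−1} − y_k)/(y_{k−2} − y_k) − A/(A+B)| ≤ C·(1/k + k^{3/2}·√ε). -/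
/-- Lower bound on the rescaled length of the interval `[y_k, y_{k-2}]`. -/
theorem one_div_le_scaled_gap {r M t s q a c e : ℝ} (hr : 0 < r) (ht : 0 < t)
    (hs : 0 < s) (hq : 1 ≤ q) (hat : a ≤ (1 + r) * t) (hca : c ≤ a)
    (hac : a ^ 2 - c ^ 2 = 2 * (1 + r)) (he : |e| ≤ 2 * t ^ 2 * M)
    (hsmall : 4 * M * (t ^ 3 * s) ≤ 1) :
    1 / (2 * t) ≤ q * (a - c) + e * s := by
  have hgap : 1 / t ≤ a - c := by
    have hfac : (a - c) * (a + c) = 2 * (1 + r) := by linarith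
    have hle : (a - c) * (a + c) ≤ (a - c) * (2 * ((1 + r) * t)) :=
      mul_le_mul_of_nonneg_left (by linarith) (by linarith)
    rw [div_le_iff₀ ht]
    nlinarith
  have hqgap : 1 / t ≤ q * (a - c) := by nlinarith
  have hes : -(1 / (2 * t)) ≤ e * s := by
    have h1 : -(2 * t ^ 2 * M) * s ≤ e * s :=
      mul_le_mul_of_nonneg_right (abs_le.mp he).1 hs.le
    have h2 : 2 * t ^ 2 * M * s ≤ 1 / (2 * t) := by
      rw [le_div_iff₀ (by positivity)]
      linarith
    linarith
  have hhalf : 1 / t = 1 / (2 * t) + 1 / (2 * t) := by field_simp; norm_num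
  linarith

/-- The rescaled leading-order gaps have ratio `1 / (1 + r)` up to a term of order `t⁻³`. -/
theorem abs_gap_sub_le {r t a b c : ℝ} (hr : 0 < r) (ht : 0 < t)
    (ha : t / 2 ≤ a) (hb : t / 2 ≤ b) (hc : t / 2 ≤ c)
    (hab : a ^ 2 - b ^ 2 = 2) (hac : a ^ 2 - c ^ 2 = 2 * (1 + r)) :
    |(a - b) - 1 / (1 + r) * (a - c)| ≤ 4 * r / t ^ 3 := by
  have ha0 : 0 < a := by linarith
  have hb0 : 0 < b := by linarith
  have hc0 : 0 < c := by linarith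
  have hab' : a - b = 2 / (a + b) := by
    rw [eq_div_iff (by positivity)]; linarith
  have hac' : a - c = 2 * (1 + r) / (a + c) := by
    rw [eq_div_iff (by positivity)]; linarith
  have hbc' : b - c = 2 * r / (b + c) := by
    rw [eq_div_iff (by positivity)]; linarith
  have hrw : (a - b) - 1 / (1 + r) * (a - c)
      = -(4 * r / ((a + b) * (a + c) * (b + c))) := by
    have h : (a - b) - 1 / (1 + r) * (a - c) = -(2 * (b - c) / ((a + b) * (a + c))) := by
      rw [hab', hac']
      field_simp
      ring
    rw [h, hbc']
    field_simp
    ring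
  rw [hrw, abs_neg, abs_of_pos (by positivity)]
  have hprod : t ^ 3 ≤ (a + b) * (a + c) * (b + c) := by
    calc t ^ 3 = t * t * t := by ring
      _ ≤ (a + b) * (a + c) * (b + c) := by gcongr <;> linarith
  gcongr

/-- Ratio estimate in the rescaled variables `t = √k`, `s = √ε`. -/
theorem abs_scaled_ratio_sub_le {r M t s q a b c e₁ e₂ : ℝ} (hr : 0 < r) (hM : 0 < M)
    (ht : 0 < t) (hs : 0 < s) (hq1 : 1 ≤ q) (hq2 : q ≤ 2)
    (ha : t / 2 ≤ a) (hb : t / 2 ≤ b) (hc : t / 2 ≤ c) (hat : a ≤ (1 + r) * t)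
    (hab : a ^ 2 - b ^ 2 = 2) (hac : a ^ 2 - c ^ 2 = 2 * (1 + r))
    (he₁ : |e₁| ≤ 2 * t ^ 2 * M) (he₂ : |e₂| ≤ 2 * t ^ 2 * M)
    (hsmall : 4 * M * (t ^ 3 * s) ≤ 1) :
    0 < q * (a - c) + e₂ * s ∧
      |(q * (a - b) + e₁ * s) / (q * (a - c) + e₂ * s) - 1 / (1 + r)|
        ≤ (16 * r + 8 * M) * (1 / t ^ 2 + t ^ 3 * s) := by
  have hca : c ≤ a := by nlinarith
  have hden := one_div_le_scaled_gap hr ht hs hq1 hat hca hac he₂ hsmall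
  have hpos : 0 < q * (a - c) + e₂ * s := lt_of_lt_of_le (by positivity) hden
  refine ⟨hpos, ?_⟩
  set D := q * (a - c) + e₂ * s with hD
  have hsplit : (q * (a - b) + e₁ * s) / D - 1 / (1 + r)
      = (q * ((a - b) - 1 / (1 + r) * (a - c)) + (e₁ - 1 / (1 + r) * e₂) * s) / D := by
    rw [eq_div_iff hpos.ne', sub_mul, div_mul_cancel₀ _ hpos.ne', hD]
    ring
  have hθ : 1 / (1 + r) ≤ 1 := by
    rw [div_le_one (by positivity)]; linarith
  have hθ0 : 0 < 1 / (1 + r) := by positivity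
  have hmain : |q * ((a - b) - 1 / (1 + r) * (a - c))| ≤ 8 * r / t ^ 3 := by
    rw [abs_mul, abs_of_pos (by linarith : 0 < q)]
    calc q * |(a - b) - 1 / (1 + r) * (a - c)| ≤ 2 * (4 * r / t ^ 3) :=
          mul_le_mul hq2 (abs_gap_sub_le hr ht ha hb hc hab hac) (abs_nonneg _) (by norm_num)
      _ = 8 * r / t ^ 3 := by ring
  have herr : |(e₁ - 1 / (1 + r) * e₂) * s| ≤ 4 * t ^ 2 * M * s := by
    rw [abs_mul, abs_of_pos hs]
    refine mul_le_mul_of_nonneg_right ?_ hs.le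
    have h1 := abs_sub e₁ (1 / (1 + r) * e₂)
    rw [abs_mul, abs_of_pos hθ0] at h1
    have h2 := mul_le_of_le_one_left (abs_nonneg e₂) hθ
    linarith
  rw [hsplit, abs_div, abs_of_pos hpos, div_le_iff₀ hpos]
  calc _ ≤ 8 * r / t ^ 3 + 4 * t ^ 2 * M * s :=
        (abs_add_le _ _).trans (add_le_add hmain herr)
    _ = (16 * r * (1 / t ^ 2) + 8 * M * (t ^ 3 * s)) * (1 / (2 * t)) := by
        field_simp; ring
    _ ≤ (16 * r + 8 * M) * (1 / t ^ 2 + t ^ 3 * s) * D := by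
        refine mul_le_mul ?_ hden (by positivity) (by positivity)
        have h1 : 0 < r * (t ^ 3 * s) := by positivity
        have h2 : 0 < M * (1 / t ^ 2) := by positivity
        linarith


/-- Quantified estimate of the hysteresis fraction `q_{[y_k, y_{k−2}]}`: there are constants
`C, c₀ > 0` depending only on `A, B, M` such that for every `ε > 0`, every odd `k ≥ 3` with
`k^{3/2}√ε ≤ c₀`, and every choice of corrections `ζ_j` with `|ζ_j| ≤ jM` (`j = k−2, k−1, k`),
the points `y_j = −√2·√(j + (j−1)B/A)·√ε + ζ_j·ε` (odd `j`),
`y_j = −√2·√((j−1) + jB/A)·√ε + ζ_j·ε` (even `j`) satisfy `y_{k−2} − y_k ≠ 0` and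
`|(y_{k−1} − y_k)/(y_{k−2} − y_k) − A/(A+B)| ≤ C(1/k + k^{3/2}√ε)`. -/
theorem stmt6 (A B M : ℝ) (hA : 0 < A) (hB : 0 < B) (hM : 0 < M) :
    ∃ C : ℝ, 0 < C ∧ ∃ c₀ : ℝ, 0 < c₀ ∧
      ∀ ε : ℝ, 0 < ε → ∀ k : ℕ, Odd k → 3 ≤ k →
        (k : ℝ) ^ ((3 : ℝ) / 2) * Real.sqrt ε ≤ c₀ →
        ∀ zk2 zk1 zk : ℝ,
          |zk2| ≤ ((k : ℝ) - 2) * M → |zk1| ≤ ((k : ℝ) - 1) * M → |zk| ≤ (k : ℝ) * M →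
          ((-Real.sqrt 2 * Real.sqrt (((k : ℝ) - 2) + ((k : ℝ) - 3) * B / A) * Real.sqrt ε
              + zk2 * ε)
            - (-Real.sqrt 2 * Real.sqrt ((k : ℝ) + ((k : ℝ) - 1) * B / A) * Real.sqrt ε
              + zk * ε) ≠ 0) ∧
          |((-Real.sqrt 2 * Real.sqrt (((k : ℝ) - 2) + ((k : ℝ) - 1) * B / A) * Real.sqrt ε
              + zk1 * ε)
            - (-Real.sqrt 2 * Real.sqrt ((k : ℝ) + ((k : ℝ) - 1) * B / A) * Real.sqrt ε
              + zk * ε)) /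
          ((-Real.sqrt 2 * Real.sqrt (((k : ℝ) - 2) + ((k : ℝ) - 3) * B / A) * Real.sqrt ε
              + zk2 * ε)
            - (-Real.sqrt 2 * Real.sqrt ((k : ℝ) + ((k : ℝ) - 1) * B / A) * Real.sqrt ε
              + zk * ε))
          - A / (A + B)| ≤ C * (1 / (k : ℝ) + (k : ℝ) ^ ((3 : ℝ) / 2) * Real.sqrt ε) := by
  refine ⟨16 * (B / A) + 8 * M, by positivity, 1 / (4 * M), by positivity, ?_⟩
  intro ε hε k _ hk hsmall zk2 zk1 zk hz2 hz1 hz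
  have hk3 : (3 : ℝ) ≤ k := by exact_mod_cast hk
  set K : ℝ := (k : ℝ)
  have hr : 0 < B / A := by positivity
  have hθ : A / (A + B) = 1 / (1 + B / A) := by field_simp
  rw [mul_div_assoc, mul_div_assoc, hθ]
  set r := B / A
  have hs : 0 < √ε := Real.sqrt_pos.mpr hε
  have hss : √ε * √ε = ε := Real.mul_self_sqrt hε.le
  have ht : 0 < √K := Real.sqrt_pos.mpr (by linarith)
  have htt : √K ^ 2 = K := Real.sq_sqrt (by linarith)
  have hpow : K ^ ((3 : ℝ) / 2) = √K ^ 3 := by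
    rw [Real.sqrt_eq_rpow, ← Real.rpow_natCast, ← Real.rpow_mul (by linarith)]
    norm_num
  rw [hpow] at hsmall ⊢
  rw [le_div_iff₀ (by positivity)] at hsmall
  have hlower {x : ℝ} (hx : K - 2 ≤ x) : √K / 2 ≤ √x := by
    apply Real.le_sqrt_of_sq_le
    rw [div_pow, htt]
    linarith
  have h1 : 0 ≤ (K - 1) * r := mul_nonneg (by linarith) hr.le
  have h3 : 0 ≤ (K - 3) * r := mul_nonneg (by linarith) hr.le
  have hat : √(K + (K - 1) * r) ≤ (1 + r) * √K := by
    apply Real.sqrt_le_iff.mpr ⟨by positivity, ?_⟩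
    rw [mul_pow, htt]
    have : 0 ≤ r ^ 2 * K := by positivity
    nlinarith
  have hasq : √(K + (K - 1) * r) ^ 2 = K + (K - 1) * r := Real.sq_sqrt (by linarith)
  have hbsq : √(K - 2 + (K - 1) * r) ^ 2 = K - 2 + (K - 1) * r := Real.sq_sqrt (by linarith)
  have hcsq : √(K - 2 + (K - 3) * r) ^ 2 = K - 2 + (K - 3) * r := Real.sq_sqrt (by linarith)
  have herr {z : ℝ} (h : |z| ≤ K * M) : |z - zk| ≤ 2 * √K ^ 2 * M := by
    rw [htt]
    linarith [abs_sub z zk]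
  have key := abs_scaled_ratio_sub_le (q := √2) (b := √(K - 2 + (K - 1) * r))
    (c := √(K - 2 + (K - 3) * r)) (e₁ := zk1 - zk) (e₂ := zk2 - zk)
    hr hM ht hs
    (Real.one_le_sqrt.mpr (by norm_num)) (Real.sqrt_le_iff.mpr (by norm_num))
    (hlower (by linarith)) (hlower (by linarith)) (hlower (by linarith)) hat
    (by rw [hasq, hbsq]; ring) (by rw [hasq, hcsq]; ring)
    (herr (by linarith)) (herr (by linarith)) (by linarith)
  rw [htt] at key
  obtain ⟨hpos, hbound⟩ := key
  have hfactor (x y z : ℝ) : (-√2 * x * √ε + z * ε) - (-√2 * y * √ε + zk * ε)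
      = √ε * (√2 * (y - x) + (z - zk) * √ε) := by
    linear_combination (zk - z) * hss
  rw [hfactor, hfactor, mul_div_mul_left _ _ hs.ne']
  exact ⟨(mul_pos hs hpos).ne', hbound⟩
end

section
/- Let c > 0, K₀, K₁, K₂ > 0 and let J ⊆ ℝ be an interval. Then there exists a constant M > 0, depending only on c, K₀, K₁, K₂, with the following property. Let δ > 0, let H : ℝ → ℝ be twice continuously differentiable on J with c ≤ H ≤ K₀, |H'| ≤ K₁ and |H''| ≤ K₂ on J, and let y_k, y_{k+1}, y_{k+2}, y_{k+3}, y_{k+4} ∈ J satisfy y_{k+2} = y_k − H(y_k)δ, y_{k+3} = y_{k+1} − H(y_{k+1})δ, y_{k+4} = y_{k+2} − H(y_{k+2})δ, and y_{k+1} = y_k − (1−q)H(y_k)δ where q = (y_{k+1} − y_{k+2})/(y_k − y_{k+2}) satisfies 0 ≤ q ≤ 1. Then, with q' = (y_{k+3} − y_{k+4})/(y_{k+2} − y_{k+4}), one has |q' − q| ≤ M·δ². -/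
/-- Linear interpolation error of a function whose second derivative is bounded by `K`. -/
theorem abs_convex_combination_sub_le {J : Set ℝ} (hJ : Convex ℝ J) {f f' f'' : ℝ → ℝ} {K : ℝ}
    (hf : ∀ y ∈ J, HasDerivWithinAt f (f' y) J y)
    (hf' : ∀ y ∈ J, HasDerivWithinAt f' (f'' y) J y)
    (hK : ∀ y ∈ J, |f'' y| ≤ K) {a b q : ℝ} (ha : a ∈ J) (hb : b ∈ J) (hba : b ≤ a)
    (hq₀ : 0 ≤ q) (hq₁ : q ≤ 1) :
    |q * f a + (1 - q) * f b - f (q * a + (1 - q) * b)| ≤ K * (a - b) ^ 2 := by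
  have hK₀ : 0 ≤ K := (abs_nonneg _).trans (hK a ha)
  have hsub : Set.Icc b a ⊆ J := hJ.ordConnected.out hb ha
  set m := q * a + (1 - q) * b with hm
  have hbm : b ≤ m := by nlinarith
  have hma : m ≤ a := by nlinarith
  have hmJ : m ∈ J := hsub ⟨hbm, hma⟩
  have hderiv : ∀ y ∈ Set.Icc b a, ‖f' y - f' m‖ ≤ K * (a - b) := fun y hy => by
    refine (hJ.norm_image_sub_le_of_norm_hasDerivWithin_le hf' hK hmJ (hsub hy)).trans ?_
    refine mul_le_mul_of_nonneg_left ?_ hK₀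
    exact abs_le.2 ⟨by linarith [hy.1], by linarith [hy.2]⟩
  have htaylor : ∀ y ∈ Set.Icc b a,
      |f y - f' m * y - (f m - f' m * m)| ≤ K * (a - b) * (a - b) := fun y hy => by
    have hg : ∀ z ∈ Set.Icc b a,
        HasDerivWithinAt (fun z => f z - f' m * z) (f' z - f' m) (Set.Icc b a) z := fun z hz => by
      simpa using ((hf z (hsub hz)).mono hsub).fun_sub
        ((hasDerivWithinAt_id z (Set.Icc b a)).const_mul (f' m))
    refine ((convex_Icc b a).norm_image_sub_le_of_norm_hasDerivWithin_le hg hderiv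
      ⟨hbm, hma⟩ hy).trans ?_
    refine mul_le_mul_of_nonneg_left ?_ (mul_nonneg hK₀ (sub_nonneg.2 hba))
    exact abs_le.2 ⟨by linarith [hy.1], by linarith [hy.2]⟩
  obtain ⟨h₁, h₂⟩ := abs_le.1 (htaylor a ⟨hba, le_rfl⟩)
  obtain ⟨h₃, h₄⟩ := abs_le.1 (htaylor b ⟨le_rfl, hba⟩)
  have hsplit : q * f a + (1 - q) * f b - f m =
      q * (f a - f' m * a - (f m - f' m * m)) +
        (1 - q) * (f b - f' m * b - (f m - f' m * m)) := by
    rw [hm]; ring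
  have hq₁' : 0 ≤ 1 - q := sub_nonneg.2 hq₁
  rw [hsplit, abs_le]
  constructor
  · linarith [mul_le_mul_of_nonneg_left h₁ hq₀, mul_le_mul_of_nonneg_left h₃ hq₁']
  · linarith [mul_le_mul_of_nonneg_left h₂ hq₀, mul_le_mul_of_nonneg_left h₄ hq₁']

/-- Second key bound in the proof of the paper's Lemma 1: for a positive, bounded, `C²`
step-size function `H` on an interval `J` with `c ≤ H ≤ K₀`, `|H'| ≤ K₁`, `|H''| ≤ K₂`,
consecutive hysteresis fractions `q` and `q'` built from `y_{j+2} = y_j − H(y_j)δ`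
differ by at most `M·δ²`, with `M` depending only on `c, K₀, K₁, K₂`. -/
theorem stmt8 (c K₀ K₁ K₂ : ℝ) (hc : 0 < c) (hK₀ : 0 < K₀) (hK₁ : 0 < K₁) (hK₂ : 0 < K₂)
    (J : Set ℝ) (hJ : Convex ℝ J) :
    ∃ M : ℝ, 0 < M ∧
      ∀ δ : ℝ, 0 < δ →
      ∀ H H' H'' : ℝ → ℝ,
        (∀ y ∈ J, HasDerivWithinAt H (H' y) J y) →
        (∀ y ∈ J, HasDerivWithinAt H' (H'' y) J y) →
        ContinuousOn H'' J →
        (∀ y ∈ J, c ≤ H y ∧ H y ≤ K₀ ∧ |H' y| ≤ K₁ ∧ |H'' y| ≤ K₂) →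
        ∀ yk yk1 yk2 yk3 yk4 : ℝ,
          yk ∈ J → yk1 ∈ J → yk2 ∈ J → yk3 ∈ J → yk4 ∈ J →
          yk2 = yk - H yk * δ → yk3 = yk1 - H yk1 * δ → yk4 = yk2 - H yk2 * δ →
          ∀ q : ℝ, q = (yk1 - yk2) / (yk - yk2) → 0 ≤ q → q ≤ 1 →
            yk1 = yk - (1 - q) * H yk * δ →
            |(yk3 - yk4) / (yk2 - yk4) - q| ≤ M * δ ^ 2 := by
  refine ⟨K₂ * K₀ ^ 2 / c, by positivity, ?_⟩
  intro δ hδ H H' H'' hH hH' _ hbd a m b y₃ y₄ ha _ hb _ _ hb_eq hy₃ hy₄ q _ hq₀ hq₁ hm_eq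
  obtain ⟨hca, haK, -, -⟩ := hbd a ha
  have hcb : c ≤ H b := (hbd b hb).1
  have hHb : 0 < H b := hc.trans_le hcb
  have hm : m = q * a + (1 - q) * b := by rw [hm_eq, hb_eq]; ring
  have hab : a - b = H a * δ := by rw [hb_eq]; ring
  have hba : b ≤ a := sub_nonneg.1 (hab ▸ mul_nonneg (hc.le.trans hca) hδ.le)
  have hinterp := abs_convex_combination_sub_le hJ hH hH' (fun y hy => (hbd y hy).2.2.2)
    ha hb hba hq₀ hq₁
  rw [← hm, hab] at hinterp
  have hquot : (y₃ - y₄) / (b - y₄) - q = (q * H a + (1 - q) * H b - H m) / H b := by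
    have hnum : y₃ - y₄ = (q * H a - H m + H b) * δ := by
      rw [hy₃, hy₄]; linear_combination hm + q * hab
    have hden : b - y₄ = H b * δ := by rw [hy₄]; ring
    rw [hnum, hden]
    field_simp
    ring
  rw [hquot, abs_div, abs_of_pos hHb]
  have hstep : K₂ * (H a * δ) ^ 2 ≤ K₂ * (K₀ * δ) ^ 2 := by
    have : 0 ≤ H a := hc.le.trans hca
    gcongr
  calc |q * H a + (1 - q) * H b - H m| / H b
      ≤ K₂ * (K₀ * δ) ^ 2 / c := div_le_div₀ (by positivity) (hinterp.trans hstep) hc hcb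
    _ = K₂ * K₀ ^ 2 / c * δ ^ 2 := by ring
end

section
/- Let φ : ℝ × ℝ → ℝ be continuously differentiable and satisfy φ(u, −s) = −φ(u, s) for all u, s. Let Q : ℝ × ℝ → ℝ be continuously differentiable in the time variable, three times continuously differentiable in the space variable, with continuous mixed partial derivatives, satisfying the backward equation ∂Q/∂s (u, s) = −φ(u, s)·∂Q/∂u (u, s) − (1/2)·∂²Q/∂u² (u, s) for all (u, s). Define p(u, s) = ∂Q/∂u (u, −s). Then p satisfies the forward (Fokker–Planck) equation ∂p/∂s (u, s) = −∂/∂u (φ(u, s)·p(u, s)) + (1/2)·∂²p/∂u² (u, s) for all (u, s). -/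
/-- Time-odd drift relates the backward Kolmogorov equation to the forward Fokker–Planck
equation: if `φ(u, −s) = −φ(u, s)` and `Q` solves
`∂Q/∂s = −φ·∂Q/∂u − (1/2)·∂²Q/∂u²`, then `p(u, s) = ∂Q/∂u(u, −s)` solves
`∂p/∂s = −∂/∂u(φ·p) + (1/2)·∂²p/∂u²`, i.e. for all `u, s` the function `t ↦ Qu(u, −t)`
has derivative `−(φu·p + φ·∂p/∂u) + (1/2)·∂²p/∂u²` at `s`. -/
theorem stmt12 (φ φu : ℝ → ℝ → ℝ)
    (hφC : Continuous fun p : ℝ × ℝ => φ p.1 p.2)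
    (hφuC : Continuous fun p : ℝ × ℝ => φu p.1 p.2)
    (hφu : ∀ u s : ℝ, HasDerivAt (fun x => φ x s) (φu u s) u)
    (hodd : ∀ u s : ℝ, φ u (-s) = -φ u s)
    (Q Qu Quu Quuu Qs Qus : ℝ → ℝ → ℝ)
    (hQu : ∀ u s : ℝ, HasDerivAt (fun x => Q x s) (Qu u s) u)
    (hQuu : ∀ u s : ℝ, HasDerivAt (fun x => Qu x s) (Quu u s) u)
    (hQuuu : ∀ u s : ℝ, HasDerivAt (fun x => Quu x s) (Quuu u s) u)
    (hQs : ∀ u s : ℝ, HasDerivAt (fun t => Q u t) (Qs u s) s)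
    (hQus : ∀ u s : ℝ, HasDerivAt (fun t => Qu u t) (Qus u s) s)
    (hmixed : ∀ u s : ℝ, HasDerivAt (fun x => Qs x s) (Qus u s) u)
    (hQuC : Continuous fun p : ℝ × ℝ => Qu p.1 p.2)
    (hQuuC : Continuous fun p : ℝ × ℝ => Quu p.1 p.2)
    (hQuuuC : Continuous fun p : ℝ × ℝ => Quuu p.1 p.2)
    (hQsC : Continuous fun p : ℝ × ℝ => Qs p.1 p.2)
    (hQusC : Continuous fun p : ℝ × ℝ => Qus p.1 p.2)
    (hbackward : ∀ u s : ℝ, Qs u s = -φ u s * Qu u s - (1 / 2) * Quu u s) :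
    ∀ u s : ℝ, HasDerivAt (fun t => Qu u (-t))
      (-(φu u s * Qu u (-s) + φ u s * Quu u (-s)) + (1 / 2) * Quuu u (-s)) s := by
  intro u s
  have hφu_odd : φu u (-s) = -φu u s := by
    have h := hφu u (-s)
    simp only [hodd] at h
    exact h.unique (hφu u s).fun_neg
  have hQus_eq : Qus u (-s) = φu u s * Qu u (-s) + φ u s * Quu u (-s) - (1 / 2) * Quuu u (-s) := by
    have h := hmixed u (-s)
    simp only [hbackward] at h
    have h' := ((hφu u (-s)).fun_neg.fun_mul (hQuu u (-s))).fun_sub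
      ((hQuuu u (-s)).const_mul (1 / 2))
    rw [h.unique h', hφu_odd, hodd]
    ring
  have h := (hQus u (-s)).scomp s (hasDerivAt_neg s)
  refine h.congr_deriv ?_
  rw [hQus_eq, smul_eq_mul]
  ring
end

section
/- Let A > 0 and set B = A². Suppose Q : ℝ × ℝ → ℝ is continuously differentiable, twice continuously differentiable in its first argument on {(u₀, r) : u₀ ≠ 0}, and satisfies the parabolic equation ∂Q/∂r = (A/B)·r·∂Q/∂u₀ + (1/(2B))·∂²Q/∂u₀² for u₀ < 0 and ∂Q/∂r = −r·∂Q/∂u₀ + (1/2)·∂²Q/∂u₀² for u₀ > 0. Define Z(u₀, r) = Q(u₀, r) + A·Q(−u₀/A, r). Then for all u₀ > 0 and all r, ∂Z/∂r = −r·∂Z/∂u₀ + (1/2)·∂²Z/∂u₀², and the one-sided derivative satisfies ∂Z/∂u₀ (0⁺, r) = 0 for all r. -/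
/-- Key computation for part (1) of the paper's Lemma 2: when `B = A²`, for a solution `Q` of
the two-piece parabolic equation, the combination `Z(u₀, r) = Q(u₀, r) + A·Q(−u₀/A, r)`
satisfies `∂Z/∂r = −r·∂Z/∂u₀ + (1/2)·∂²Z/∂u₀²` for `u₀ > 0`, and its one-sided derivative
in `u₀` at `0⁺` vanishes. -/
theorem stmt13 (A B : ℝ) (hA : 0 < A) (hB : B = A ^ 2)
    (Q Qu Quu Qr : ℝ → ℝ → ℝ)
    (hQu : ∀ u r : ℝ, HasDerivAt (fun x => Q x r) (Qu u r) u)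
    (hQr : ∀ u r : ℝ, HasDerivAt (fun s => Q u s) (Qr u r) r)
    (hQuC : Continuous fun p : ℝ × ℝ => Qu p.1 p.2)
    (hQrC : Continuous fun p : ℝ × ℝ => Qr p.1 p.2)
    (hQuu : ∀ u r : ℝ, u ≠ 0 → HasDerivAt (fun x => Qu x r) (Quu u r) u)
    (hQuuC : ContinuousOn (fun p : ℝ × ℝ => Quu p.1 p.2) {p : ℝ × ℝ | p.1 ≠ 0})
    (hpdeL : ∀ u r : ℝ, u < 0 → Qr u r = (A / B) * r * Qu u r + (1 / (2 * B)) * Quu u r)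
    (hpdeR : ∀ u r : ℝ, 0 < u → Qr u r = -r * Qu u r + (1 / 2) * Quu u r) :
    (∀ u r : ℝ, HasDerivAt (fun x => Q x r + A * Q (-x / A) r)
        (Qu u r - Qu (-u / A) r) u) ∧
    (∀ u r : ℝ, 0 < u → HasDerivAt (fun x => Qu x r - Qu (-x / A) r)
        (Quu u r + (1 / A) * Quu (-u / A) r) u) ∧
    (∀ u r : ℝ, 0 < u → HasDerivAt (fun s => Q u s + A * Q (-u / A) s)
        (-r * (Qu u r - Qu (-u / A) r)
          + (1 / 2) * (Quu u r + (1 / A) * Quu (-u / A) r)) r) ∧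
    (∀ r : ℝ, HasDerivWithinAt (fun x => Q x r + A * Q (-x / A) r) 0 (Set.Ici 0) 0) := by
  have hneg : ∀ u : ℝ, HasDerivAt (fun x : ℝ => -x / A) (-1 / A) u := fun u =>
    (hasDerivAt_id u).neg.div_const A
  have hA0 : A ≠ 0 := hA.ne'
  have hZu : ∀ u r : ℝ, HasDerivAt (fun x => Q x r + A * Q (-x / A) r)
      (Qu u r - Qu (-u / A) r) u := by
    intro u r
    have hcomp : HasDerivAt (fun x => Q (-x / A) r) (Qu (-u / A) r * (-1 / A)) u :=
      HasDerivAt.comp (h₂ := fun y => Q y r) u (hQu (-u / A) r) (hneg u)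
    refine ((hQu u r).add (hcomp.const_mul A)).congr_deriv ?_
    field_simp
    ring
  have hlt : ∀ u : ℝ, 0 < u → -u / A < 0 := fun u hu =>
    div_neg_of_neg_of_pos (neg_lt_zero.mpr hu) hA
  refine ⟨hZu, fun u r hu => ?_, fun u r hu => ?_, fun r => ?_⟩
  · have hcomp : HasDerivAt (fun x => Qu (-x / A) r) (Quu (-u / A) r * (-1 / A)) u :=
      HasDerivAt.comp (h₂ := fun y => Qu y r) u
        (hQuu (-u / A) r (hlt u hu).ne) (hneg u)
    refine ((hQuu u r hu.ne').sub hcomp).congr_deriv ?_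
    ring
  · refine ((hQr u r).add ((hQr (-u / A) r).const_mul A)).congr_deriv ?_
    rw [hpdeR u r hu, hpdeL _ r (hlt u hu), hB]
    field_simp
    ring
  · simpa using (hZu 0 r).hasDerivWithinAt (s := Set.Ici 0)
end

section
/- Let A, B, ε > 0, let 0 ≤ t₁ ≤ t₂ ≤ t₃, and let (x, y) : [0, t₃] → ℝ × ℝ be continuous and satisfy: on [0, t₁], x'(t) = y(t) and y'(t) = 1 with x(0) = 0 and x(t₁) = −ε; on [t₁, t₂], x'(t) = −A·y(t) and y'(t) = B with x(t₂) = ε; and on [t₂, t₃], x'(t) = y(t) and y'(t) = 1 with x(t₃) = 0. Then y(t₃)² = y(0)² − 4(1 + B/A)·ε. -/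
open Set

/-- Along a solution of `(ẋ, ẏ) = (c y, d)` the quantity `c y² − 2 d x` is conserved. -/
theorem mul_sq_sub_mul_eq_of_hasDerivWithinAt {a b c d : ℝ} (hab : a ≤ b) {x y : ℝ → ℝ}
    (hx : ∀ t ∈ Icc a b, HasDerivWithinAt x (c * y t) (Icc a b) t)
    (hy : ∀ t ∈ Icc a b, HasDerivWithinAt y d (Icc a b) t) :
    c * y b ^ 2 - 2 * d * x b = c * y a ^ 2 - 2 * d * x a := by
  have hderiv : ∀ t ∈ Icc a b,
      HasDerivWithinAt (fun s => c * y s ^ 2 - 2 * d * x s) 0 (Icc a b) t := by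
    intro t ht
    refine ((((hy t ht).fun_pow 2).const_mul c).fun_sub
      ((hx t ht).const_mul (2 * d))).congr_deriv ?_
    push_cast
    ring
  refine constant_of_derivWithin_zero (fun t ht => (hderiv t ht).differentiableWithinAt)
    (fun t ht => ?_) b (right_mem_Icc.2 hab)
  have hlt : a < b := ht.1.trans_lt ht.2
  exact (hderiv t (Ico_subset_Icc_self ht)).derivWithin
    (uniqueDiffOn_Icc hlt t (Ico_subset_Icc_self ht))

/-- Change of `y²` over one hysteresis cycle of the planar two-fold normal form: an orbit
following the right half-system `(ẋ, ẏ) = (y, 1)` from `x = 0` to `x = −ε`, then the left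
half-system `(ẋ, ẏ) = (−Ay, B)` to `x = ε`, then the right half-system back to `x = 0`,
satisfies `y(t₃)² = y(0)² − 4(1 + B/A)ε`. -/
theorem stmt15 (A B ε : ℝ) (hA : 0 < A) (hB : 0 < B) (hε : 0 < ε)
    (t₁ t₂ t₃ : ℝ) (h01 : 0 ≤ t₁) (h12 : t₁ ≤ t₂) (h23 : t₂ ≤ t₃)
    (x y : ℝ → ℝ)
    (hxc : ContinuousOn x (Icc 0 t₃)) (hyc : ContinuousOn y (Icc 0 t₃))
    (hx1 : ∀ t ∈ Icc 0 t₁, HasDerivWithinAt x (y t) (Icc 0 t₁) t)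
    (hy1 : ∀ t ∈ Icc 0 t₁, HasDerivWithinAt y 1 (Icc 0 t₁) t)
    (hx0 : x 0 = 0) (hxt1 : x t₁ = -ε)
    (hx2 : ∀ t ∈ Icc t₁ t₂, HasDerivWithinAt x (-A * y t) (Icc t₁ t₂) t)
    (hy2 : ∀ t ∈ Icc t₁ t₂, HasDerivWithinAt y B (Icc t₁ t₂) t)
    (hxt2 : x t₂ = ε)
    (hx3 : ∀ t ∈ Icc t₂ t₃, HasDerivWithinAt x (y t) (Icc t₂ t₃) t)
    (hy3 : ∀ t ∈ Icc t₂ t₃, HasDerivWithinAt y 1 (Icc t₂ t₃) t)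
    (hxt3 : x t₃ = 0) :
    y t₃ ^ 2 = y 0 ^ 2 - 4 * (1 + B / A) * ε := by
  have h1 := mul_sq_sub_mul_eq_of_hasDerivWithinAt (c := 1) h01 (by simpa using hx1) hy1
  have h2 := mul_sq_sub_mul_eq_of_hasDerivWithinAt h12 hx2 hy2
  have h3 := mul_sq_sub_mul_eq_of_hasDerivWithinAt (c := 1) h23 (by simpa using hx3) hy3
  rw [hx0, hxt1] at h1
  rw [hxt1, hxt2] at h2
  rw [hxt2, hxt3] at h3
  have h2' : y t₂ ^ 2 = y t₁ ^ 2 - 4 * (B / A) * ε := by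
    field_simp
    linarith
  linarith
end
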